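/- Let x = P(x) be a minPPS in SNF with least fixed point q* satisfying 0 < q* < 1, let 0 ≤ y ≤ q*, and let σ be a policy such that P^y(N_σ(y)) = N_σ(y). Then: (i) for any policy σ', N_{σ'}(y) ≥ N_σ(y); (ii) for any x ∈ ℝ^n with P^y(x) ≥ x, we have x ≤ N_σ(y); (iii) for any x ∈ ℝ^n with P^y(x) ≤ x, we have x ≥ N_σ(y); (iv) N_σ(y) is the unique fixed point of x = P^y(x); (v) N_σ(y) ≤ q*. -/

import Mathlib

open Matrix Finset

namespace PPS

/-- One equation of a max/min PPS in simple normal form (SNF):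
form L (linear), form Q (product of two variables), or form M
(max or min of two variables, according to the kind of the system). -/
inductive Eqn (n : ℕ) where
  | lin (a0 : ℝ) (a : Fin n → ℝ) : Eqn n
  | quad (j k : Fin n) : Eqn n
  | m (j k : Fin n) : Eqn n

namespace Eqn

/-- Validity of the coefficients of a form-L equation: all coefficients,
including the constant term, are nonnegative and sum to at most 1. -/
def Valid {n : ℕ} : Eqn n → Prop
  | .lin a0 a => 0 ≤ a0 ∧ (∀ j, 0 ≤ a j) ∧ a0 + ∑ j, a j ≤ 1
  | _ => True

/-- Evaluate one equation; `isMax` says whether form-M equations are max or min. -/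
def eval {n : ℕ} (isMax : Bool) : Eqn n → (Fin n → ℝ) → ℝ
  | .lin a0 a, x => a0 + ∑ j, a j * x j
  | .quad j k, x => x j * x k
  | .m j k, x => if isMax then max (x j) (x k) else min (x j) (x k)

/-- An equation of form L or Q (no max/min). -/
def IsLinOrQuad {n : ℕ} : Eqn n → Prop
  | .m _ _ => False
  | _ => True

/-- Row of the Jacobian matrix of one (form L or Q) equation at the point `y`. -/
def jacRow {n : ℕ} : Eqn n → (Fin n → ℝ) → (Fin n → ℝ)
  | .lin _ a, _ => a
  | .quad j k, y => fun l => (if l = j then y k else 0) + (if l = k then y j else 0)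
  | .m _ _, _ => fun _ => 0

end Eqn

/-- A system of `n` equations in `n` variables, in SNF. -/
abbrev Sys (n : ℕ) : Type := Fin n → Eqn n

/-- All equations have valid (probabilistic) coefficients. -/
def SysValid {n : ℕ} (S : Sys n) : Prop := ∀ i, (S i).Valid

/-- A PPS: a system with no form-M equations. -/
def IsPPS {n : ℕ} (S : Sys n) : Prop := ∀ i, (S i).IsLinOrQuad

/-- The map `P : ℝ^n → ℝ^n` of the system. -/
def eval {n : ℕ} (isMax : Bool) (S : Sys n) (x : Fin n → ℝ) : Fin n → ℝ :=
  fun i => (S i).eval isMax x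

/-- The Jacobian matrix `P'(y)`. -/
def jac {n : ℕ} (S : Sys n) (y : Fin n → ℝ) : Matrix (Fin n) (Fin n) ℝ :=
  Matrix.of fun i l => (S i).jacRow y l

/-- `q` is the least fixed point of `x = P(x)` in `[0,1]^n`. -/
def IsLFP {n : ℕ} (isMax : Bool) (S : Sys n) (q : Fin n → ℝ) : Prop :=
  eval isMax S q = q ∧ (∀ i, 0 ≤ q i) ∧ (∀ i, q i ≤ 1) ∧
    (∀ q' : Fin n → ℝ, eval isMax S q' = q' → (∀ i, 0 ≤ q' i) → (∀ i, q' i ≤ 1) →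
      ∀ i, q i ≤ q' i)

/-- Applying a policy `σ` (a choice, for each form-M equation `max/min {x_j, x_k}`,
of one of the two variables: `true` picks `x_j`, `false` picks `x_k`) to the system,
yielding the PPS `x = P_σ(x)`. -/
def applyPolicy {n : ℕ} (S : Sys n) (σ : Fin n → Bool) : Sys n := fun i =>
  match S i with
  | .m j k => .lin 0 (fun l => if l = (if σ i then j else k) then 1 else 0)
  | e => e

/-- The linearization `P^y` of `P` at `y`: equations of form L and M are unchanged,
and a form-Q equation `x_j x_k` becomes `y_j x_k + x_j y_k - y_j y_k`. -/
def linEval {n : ℕ} (isMax : Bool) (S : Sys n) (y x : Fin n → ℝ) : Fin n → ℝ := fun i =>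
  match S i with
  | .quad j k => y j * x k + x j * y k - y j * y k
  | e => e.eval isMax x

/-- The Newton operator `N(y) = y + (I - P'(y))⁻¹ (P(y) - y)`. -/
noncomputable def newton {n : ℕ} (isMax : Bool) (S : Sys n) (y : Fin n → ℝ) : Fin n → ℝ :=
  y + (1 - jac S y)⁻¹ *ᵥ (eval isMax S y - y)

/-- the l∞ norm of a vector -/
noncomputable def vnorm {n : ℕ} (v : Fin n → ℝ) : ℝ := ⨆ i, |v i|

/-- the l∞ (max absolute row sum) norm of a matrix -/
noncomputable def mnorm {n : ℕ} (A : Matrix (Fin n) (Fin n) ℝ) : ℝ := ⨆ i, ∑ j, |A i j|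

end PPS
/-- If a nonnegative matrix has a positive superharmonic vector `v` and a superharmonic vector
`w` with a negative entry, then some nonempty closed set of indices has rows tight for `v`. -/
theorem Matrix.exists_closed_tight_of_superharmonic_neg {ι : Type*} [Fintype ι]
    (A : Matrix ι ι ℝ) (hA : ∀ i j, 0 ≤ A i j) (v w : ι → ℝ) (hv : ∀ i, 0 < v i)
    (hAv : ∀ i, ∑ j, A i j * v j ≤ v i) (hAw : ∀ i, ∑ j, A i j * w j ≤ w i)
    (i₀ : ι) (hi₀ : w i₀ < 0) :
    ∃ T : Set ι, T.Nonempty ∧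
      ∀ i ∈ T, ∑ j, A i j * v j = v i ∧ ∀ j, A i j ≠ 0 → j ∈ T := by
  have : Nonempty ι := ⟨i₀⟩
  obtain ⟨m, hm⟩ := Finite.exists_max fun i => -w i / v i
  set t := -w m / v m with ht
  have ht0 : 0 < t := (div_pos (neg_pos.2 hi₀) (hv i₀)).trans_le (hm i₀)
  have hge : ∀ i, 0 ≤ w i + t * v i := fun i => by
    have := (div_le_iff₀ (hv i)).1 (hm i)
    linarith
  refine ⟨{i | w i + t * v i = 0}, ⟨m, ?_⟩, fun i hi => ?_⟩
  · have := (hv m).ne'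
    simp only [Set.mem_ofPred_eq, ht]
    field_simp
    ring
  · have hi' : w i + t * v i = 0 := hi
    have hsum : ∑ j, A i j * (w j + t * v j)
        = ∑ j, A i j * w j + t * ∑ j, A i j * v j := by
      rw [Finset.mul_sum, ← Finset.sum_add_distrib]
      exact Finset.sum_congr rfl fun j _ => by ring
    have hnn : ∀ j ∈ Finset.univ, 0 ≤ A i j * (w j + t * v j) :=
      fun j _ => mul_nonneg (hA i j) (hge j)
    have hmul := mul_le_mul_of_nonneg_left (hAv i) ht0.le
    have hzero : ∑ j, A i j * (w j + t * v j) = 0 :=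
      le_antisymm (by linarith [hAw i]) (Finset.sum_nonneg hnn)
    refine ⟨le_antisymm (hAv i) (le_of_mul_le_mul_left ?_ ht0), fun j hj => ?_⟩
    · linarith [hAw i]
    · exact (mul_eq_zero.1 ((Finset.sum_eq_zero_iff_of_nonneg hnn).1 hzero j
        (Finset.mem_univ j))).resolve_left hj

/-- A nonempty closed set of indices with substochastic rows tight for a positive vector
contains a nonempty closed set with stochastic rows. -/
theorem Matrix.exists_closed_stochastic_of_tight {ι : Type*} [Fintype ι]
    (A : Matrix ι ι ℝ) (hA : ∀ i j, 0 ≤ A i j) (v : ι → ℝ) (hv : ∀ i, 0 < v i)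
    (T : Set ι) (hT : T.Nonempty)
    (htight : ∀ i ∈ T, ∑ j, A i j * v j = v i) (hclosed : ∀ i ∈ T, ∀ j, A i j ≠ 0 → j ∈ T)
    (hrow : ∀ i ∈ T, ∑ j, A i j ≤ 1) :
    ∃ C : Set ι, C ⊆ T ∧ C.Nonempty ∧
      ∀ i ∈ C, ∑ j, A i j = 1 ∧ ∀ j, A i j ≠ 0 → j ∈ C := by
  obtain ⟨m, hmT, hm⟩ := Set.exists_max_image T v T.toFinite hT
  refine ⟨{i | i ∈ T ∧ v i = v m}, fun i hi => hi.1, ⟨m, hmT, rfl⟩, ?_⟩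
  rintro i ⟨hiT, hi⟩
  have hsum : ∑ j, A i j * (v m - v j) = v m * ((∑ j, A i j) - 1) := by
    have : ∑ j, A i j * (v m - v j) = v m * (∑ j, A i j) - ∑ j, A i j * v j := by
      rw [Finset.mul_sum, ← Finset.sum_sub_distrib]
      exact Finset.sum_congr rfl fun j _ => by ring
    rw [this, htight i hiT, hi]
    ring
  have hnn : ∀ j ∈ Finset.univ, 0 ≤ A i j * (v m - v j) := fun j _ => by
    by_cases hj : A i j = 0
    · simp [hj]
    · exact mul_nonneg (hA i j) (sub_nonneg.2 (hm j (hclosed i hiT j hj)))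
  have hle : v m * ((∑ j, A i j) - 1) ≤ 0 :=
    mul_nonpos_of_nonneg_of_nonpos (hv m).le (by linarith [hrow i hiT])
  have hzero : ∑ j, A i j * (v m - v j) = 0 :=
    le_antisymm (hsum ▸ hle) (Finset.sum_nonneg hnn)
  refine ⟨?_, fun j hj => ⟨hclosed i hiT j hj, ?_⟩⟩
  · have := (mul_eq_zero.1 (hsum.symm.trans hzero)).resolve_left (hv m).ne'
    linarith
  · have := (mul_eq_zero.1 ((Finset.sum_eq_zero_iff_of_nonneg hnn).1 hzero j
      (Finset.mem_univ j))).resolve_left hj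
    linarith

namespace PPS

variable {n : ℕ}

theorem eval_mono {S : Sys n} (hS : SysValid S) {x x' : Fin n → ℝ}
    (hx : ∀ i, 0 ≤ x i) (hxx' : ∀ i, x i ≤ x' i) (i : Fin n) :
    eval false S x i ≤ eval false S x' i := by
  have hi := hS i
  unfold eval
  cases h : S i with
  | lin a0 a =>
    rw [h] at hi
    simp only [Eqn.eval]
    gcongr with j
    · exact hi.2.1 j
    · exact hxx' j
  | quad j k =>
    simp only [Eqn.eval]
    exact mul_le_mul (hxx' j) (hxx' k) (hx k) ((hx j).trans (hxx' j))
  | m j k =>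
    simpa [Eqn.eval] using
      And.intro (Or.inl (hxx' j) : x j ≤ x' j ∨ x k ≤ x' j)
        (Or.inr (hxx' k) : x j ≤ x' k ∨ x k ≤ x' k)

theorem eval_nonneg {S : Sys n} (hS : SysValid S) {x : Fin n → ℝ}
    (hx : ∀ i, 0 ≤ x i) (i : Fin n) : 0 ≤ eval false S x i := by
  have hi := hS i
  unfold eval
  cases h : S i with
  | lin a0 a =>
    rw [h] at hi
    exact add_nonneg hi.1 (Finset.sum_nonneg fun j _ => mul_nonneg (hi.2.1 j) (hx j))
  | quad j k => exact mul_nonneg (hx j) (hx k)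
  | m j k => simpa [Eqn.eval] using And.intro (hx j) (hx k)

theorem eval_le_one {S : Sys n} (hS : SysValid S) {x : Fin n → ℝ}
    (hx : ∀ i, 0 ≤ x i) (hx1 : ∀ i, x i ≤ 1) (i : Fin n) : eval false S x i ≤ 1 := by
  refine (eval_mono hS (x' := fun _ => 1) hx hx1 i).trans ?_
  have hi := hS i
  unfold eval
  cases h : S i with
  | lin a0 a =>
    rw [h] at hi
    simpa [Eqn.eval] using hi.2.2
  | quad j k => simp [Eqn.eval]
  | m j k => simp [Eqn.eval]

/-- The least fixed point lies below every pre-fixed point in the unit cube. -/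
theorem IsLFP.le_of_eval_le {S : Sys n} (hS : SysValid S) {q : Fin n → ℝ}
    (hq : IsLFP false S q) {r : Fin n → ℝ} (hr0 : ∀ i, 0 ≤ r i) (hr1 : ∀ i, r i ≤ 1)
    (hr : ∀ i, eval false S r i ≤ r i) (i : Fin n) : q i ≤ r i := by
  let f : (Fin n → Set.Icc (0 : ℝ) 1) →o (Fin n → Set.Icc (0 : ℝ) 1) :=
    { toFun := fun x i => ⟨eval false S (fun j => (x j : ℝ)) i,
        eval_nonneg hS (fun j => (x j).2.1) i,
        eval_le_one hS (fun j => (x j).2.1) (fun j => (x j).2.2) i⟩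
      monotone' := fun x x' hxx' i =>
        eval_mono hS (fun j => (x j).2.1) (fun j => hxx' j) i }
  have hfix : f (OrderHom.lfp f) = OrderHom.lfp f := f.map_lfp
  have hle : OrderHom.lfp f ≤ fun i => ⟨r i, hr0 i, hr1 i⟩ := f.lfp_le fun i => hr i
  refine (hq.2.2.2 (fun j => (OrderHom.lfp f j : ℝ)) ?_ (fun j => (OrderHom.lfp f j).2.1)
    (fun j => (OrderHom.lfp f j).2.2) i).trans (hle i)
  funext j
  exact congrArg Subtype.val (congrFun hfix j)

theorem jac_nonneg {B : Sys n} (hB : SysValid B) {y : Fin n → ℝ} (hy : ∀ i, 0 ≤ y i)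
    (i j : Fin n) : 0 ≤ jac B y i j := by
  have hi := hB i
  simp only [jac, Matrix.of_apply]
  cases h : B i with
  | lin a0 a =>
    rw [h] at hi
    exact hi.2.1 j
  | quad k l =>
    simp only [Eqn.jacRow]
    have := hy k
    have := hy l
    split_ifs <;> positivity
  | m k l => simp [Eqn.jacRow]

theorem sum_jac_lin {B : Sys n} {i : Fin n} {a0 : ℝ} {a : Fin n → ℝ} (h : B i = .lin a0 a)
    (y v : Fin n → ℝ) : ∑ l, jac B y i l * v l = ∑ l, a l * v l := by
  simp [jac, h, Eqn.jacRow]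

theorem sum_jac_quad {B : Sys n} {i j k : Fin n} (h : B i = .quad j k)
    (y v : Fin n → ℝ) : ∑ l, jac B y i l * v l = y k * v j + y j * v k := by
  simp [jac, h, Eqn.jacRow, add_mul, Finset.sum_add_distrib]

/-- Let `x = B(x)` be a PPS dominating the minPPS `x = S(x)` with least fixed point
`0 < q < 1`. Then `I - B'(y)` is a monotone matrix whenever `0 ≤ y ≤ q`. -/
theorem nonneg_of_jac_mulVec_le {S : Sys n} (hS : SysValid S) {q : Fin n → ℝ}
    (hq : IsLFP false S q) (h0 : ∀ i, 0 < q i) (h1 : ∀ i, q i < 1)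
    {y : Fin n → ℝ} (hy0 : ∀ i, 0 ≤ y i) (hyq : ∀ i, y i ≤ q i)
    {B : Sys n} (hB : SysValid B) (hPPS : IsPPS B)
    (hSB : ∀ x i, eval false S x i ≤ eval false B x i)
    {w : Fin n → ℝ} (hw : ∀ i, ∑ j, jac B y i j * w j ≤ w i) (i : Fin n) : 0 ≤ w i := by
  by_contra! hneg
  have hqB : ∀ i, q i ≤ eval false B q i := fun i =>
    (congrFun hq.1 i).symm.le.trans (hSB q i)
  have hv : ∀ i, 0 < 1 - q i := fun i => sub_pos.2 (h1 i)
  have hlin : ∀ i a0 a, B i = .lin a0 a → ∑ j, jac B y i j * (1 - q j) ≤ 1 - q i := by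
    intro i a0 a h
    have hi := hB i
    have hqi := hqB i
    rw [h] at hi
    simp only [eval, h, Eqn.eval] at hqi
    rw [sum_jac_lin h y fun j => 1 - q j]
    simp only [mul_sub, mul_one, Finset.sum_sub_distrib]
    linarith [hi.2.2]
  have hquad : ∀ i j k, B i = .quad j k → ∑ l, jac B y i l * (1 - q l) < 1 - q i := by
    intro i j k h
    have hqi := hqB i
    simp only [eval, h, Eqn.eval] at hqi
    rw [sum_jac_quad h y fun j => 1 - q j]
    nlinarith [mul_pos (hv j) (hv k), mul_le_mul_of_nonneg_right (hyq k) (hv j).le,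
      mul_le_mul_of_nonneg_right (hyq j) (hv k).le]
  have hAv : ∀ i, ∑ j, jac B y i j * (1 - q j) ≤ 1 - q i := by
    intro i
    cases h : B i with
    | lin a0 a => exact hlin i a0 a h
    | quad j k => exact (hquad i j k h).le
    | m j k => exact absurd (hPPS i) (by simp [h, Eqn.IsLinOrQuad])
  obtain ⟨T, hTne, hT⟩ := Matrix.exists_closed_tight_of_superharmonic_neg (jac B y)
    (jac_nonneg hB hy0) (fun i => 1 - q i) w hv hAv hw i hneg
  have hTlin : ∀ i ∈ T, ∃ a0 a, B i = .lin a0 a := by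
    intro i hi
    cases h : B i with
    | lin a0 a => exact ⟨a0, a, rfl⟩
    | quad j k => exact absurd (hT i hi).1 (hquad i j k h).ne
    | m j k => exact absurd (hPPS i) (by simp [h, Eqn.IsLinOrQuad])
  have hrow : ∀ i ∈ T, ∑ j, jac B y i j ≤ 1 := by
    intro i hi
    obtain ⟨a0, a, h⟩ := hTlin i hi
    have hi := hB i
    rw [h] at hi
    have := sum_jac_lin h y fun _ => 1
    simp only [mul_one] at this
    linarith [hi.1, hi.2.2]
  obtain ⟨C, hCT, ⟨c, hc⟩, hC⟩ := Matrix.exists_closed_stochastic_of_tight (jac B y)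
    (jac_nonneg hB hy0) (fun i => 1 - q i) hv T hTne (fun i hi => (hT i hi).1)
    (fun i hi => (hT i hi).2) hrow
  classical
  let r : Fin n → ℝ := fun i => if i ∈ C then 0 else q i
  have hr0 : ∀ i, 0 ≤ r i := fun i => by
    by_cases hi : i ∈ C <;> simp [r, hi, (h0 i).le]
  have hrq : ∀ i, r i ≤ q i := fun i => by
    by_cases hi : i ∈ C <;> simp [r, hi, (h0 i).le]
  have hr : ∀ i, eval false S r i ≤ r i := by
    intro i
    by_cases hi : i ∈ C
    · obtain ⟨a0, a, h⟩ := hTlin i (hCT hi)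
      have hBi := hB i
      rw [h] at hBi
      have hone := sum_jac_lin h y fun _ => 1
      simp only [mul_one, (hC i hi).1] at hone
      have hzero : ∑ j, a j * r j = 0 := by
        rw [← sum_jac_lin h y]
        refine Finset.sum_eq_zero fun j _ => ?_
        by_cases hj : jac B y i j = 0
        · simp [hj]
        · simp [r, (hC i hi).2 j hj]
      refine (hSB r i).trans ?_
      simp only [eval, h, Eqn.eval, hzero]
      simp only [r, hi, if_true]
      linarith [hBi.2.2]
    · refine ((eval_mono hS hr0 hrq i).trans (congrFun hq.1 i).le).trans ?_
      simp [r, hi]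
  have := hq.le_of_eval_le hS hr0 (fun i => (hrq i).trans (h1 i).le) hr c
  simp only [r, hc, if_true] at this
  exact absurd this (h0 c).not_ge

theorem applyPolicy_isPPS (S : Sys n) (σ : Fin n → Bool) : IsPPS (applyPolicy S σ) := by
  intro i
  cases h : S i <;> simp [applyPolicy, h, Eqn.IsLinOrQuad]

theorem applyPolicy_valid {S : Sys n} (hS : SysValid S) (σ : Fin n → Bool) :
    SysValid (applyPolicy S σ) := by
  intro i
  have hi := hS i
  cases h : S i with
  | lin a0 a => simpa [applyPolicy, h] using hi
  | quad j k => simp [applyPolicy, h, Eqn.Valid]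
  | m j k =>
    simp only [applyPolicy, h, Eqn.Valid]
    refine ⟨le_rfl, fun l => ?_, by simp⟩
    split_ifs <;> norm_num

theorem eval_le_eval_applyPolicy (S : Sys n) (σ : Fin n → Bool) (x : Fin n → ℝ) (i : Fin n) :
    eval false S x i ≤ eval false (applyPolicy S σ) x i := by
  cases h : S i with
  | lin a0 a => simp [eval, applyPolicy, h]
  | quad j k => simp [eval, applyPolicy, h]
  | m j k => cases hσ : σ i <;> simp [eval, applyPolicy, h, Eqn.eval, hσ]

theorem linEval_le_linEval_applyPolicy (S : Sys n) (σ : Fin n → Bool) (y x : Fin n → ℝ)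
    (i : Fin n) : linEval false S y x i ≤ linEval false (applyPolicy S σ) y x i := by
  cases h : S i with
  | lin a0 a => simp [linEval, applyPolicy, h]
  | quad j k => simp [linEval, applyPolicy, h]
  | m j k => cases hσ : σ i <;> simp [linEval, applyPolicy, h, Eqn.eval, hσ]

/-- At every point some policy attains the minimum in all form-M equations. -/
theorem exists_linEval_applyPolicy_eq (S : Sys n) (y x : Fin n → ℝ) :
    ∃ τ : Fin n → Bool, linEval false (applyPolicy S τ) y x = linEval false S y x := by
  have hex : ∀ i, ∃ b : Bool, ∀ τ : Fin n → Bool, τ i = b →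
      linEval false (applyPolicy S τ) y x i = linEval false S y x i := by
    intro i
    cases h : S i with
    | lin a0 a => exact ⟨true, fun τ _ => by simp [linEval, applyPolicy, h]⟩
    | quad j k => exact ⟨true, fun τ _ => by simp [linEval, applyPolicy, h]⟩
    | m j k =>
      rcases le_total (x j) (x k) with hjk | hjk
      · exact ⟨true, fun τ hτ => by simp [linEval, applyPolicy, h, Eqn.eval, hτ, hjk]⟩
      · exact ⟨false, fun τ hτ => by simp [linEval, applyPolicy, h, Eqn.eval, hτ, hjk]⟩
  choose τ hτ using hex
  exact ⟨τ, funext fun i => hτ i τ rfl⟩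

/-- The linearization of a PPS is its first-order Taylor expansion. -/
theorem linEval_eq_eval_add {B : Sys n} (hPPS : IsPPS B) (y x : Fin n → ℝ) (i : Fin n) :
    linEval false B y x i = eval false B y i + ∑ j, jac B y i j * (x j - y j) := by
  cases h : B i with
  | lin a0 a =>
    rw [sum_jac_lin h y fun j => x j - y j]
    simp [linEval, eval, h, Eqn.eval, mul_sub, Finset.sum_sub_distrib]
  | quad j k =>
    rw [sum_jac_quad h y fun j => x j - y j]
    simp only [linEval, eval, h, Eqn.eval]
    ring
  | m j k => exact absurd (hPPS i) (by simp [h, Eqn.IsLinOrQuad])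

theorem isUnit_one_sub_jac {B : Sys n} {y : Fin n → ℝ}
    (hmono : ∀ w : Fin n → ℝ, (∀ i, ∑ j, jac B y i j * w j ≤ w i) → ∀ i, 0 ≤ w i) :
    IsUnit (1 - jac B y) := by
  refine Matrix.mulVec_injective_iff_isUnit.1
    ((injective_iff_map_eq_zero (1 - jac B y).mulVecLin).2 fun w hw => ?_)
  have hw' : ∀ i, ∑ j, jac B y i j * w j = w i := fun i => by
    have := congrFun hw i
    simp only [Matrix.mulVecLin_apply, Matrix.sub_mulVec, Matrix.one_mulVec, Pi.sub_apply,
      Pi.zero_apply] at this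
    exact (sub_eq_zero.1 this).symm
  funext i
  refine le_antisymm ?_ (hmono w (fun i => (hw' i).le) i)
  have := hmono (-w) (fun i => by simp [hw' i]) i
  simpa using this

/-- The Newton iterate of a PPS is a fixed point of its linearization. -/
theorem linEval_newton {B : Sys n} (hPPS : IsPPS B) {y : Fin n → ℝ}
    (hunit : IsUnit (1 - jac B y)) (i : Fin n) :
    linEval false B y (newton false B y) i = newton false B y i := by
  have hmul : (1 - jac B y) *ᵥ (newton false B y - y) = eval false B y - y := by
    rw [newton, add_sub_cancel_left, Matrix.mulVec_mulVec,
      Matrix.mul_nonsing_inv _ ((Matrix.isUnit_iff_isUnit_det _).1 hunit), Matrix.one_mulVec]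
  rw [Matrix.sub_mulVec, Matrix.one_mulVec] at hmul
  have hi := congrFun hmul i
  simp only [Pi.sub_apply, Matrix.mulVec, dotProduct] at hi
  rw [linEval_eq_eval_add hPPS]
  linarith

/-- Comparison principle: post-fixed points of the linearization of a PPS lie below its
pre-fixed points. -/
theorem le_of_le_linEval_of_linEval_le {B : Sys n} (hPPS : IsPPS B) {y : Fin n → ℝ}
    (hmono : ∀ w : Fin n → ℝ, (∀ i, ∑ j, jac B y i j * w j ≤ w i) → ∀ i, 0 ≤ w i)
    {x z : Fin n → ℝ} (hx : ∀ i, x i ≤ linEval false B y x i)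
    (hz : ∀ i, linEval false B y z i ≤ z i) (i : Fin n) : x i ≤ z i := by
  refine sub_nonneg.1 (hmono (fun i => z i - x i) (fun i => ?_) i)
  have hxi := hx i
  have hzi := hz i
  rw [linEval_eq_eval_add hPPS] at hxi hzi
  simp only [mul_sub, Finset.sum_sub_distrib] at hxi hzi ⊢
  linarith

theorem linEval_le_eval (S : Sys n) {x y : Fin n → ℝ} (hyx : ∀ i, y i ≤ x i) (i : Fin n) :
    linEval false S y x i ≤ eval false S x i := by
  cases h : S i with
  | lin a0 a => simp [linEval, eval, h]
  | quad j k =>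
    simp only [linEval, eval, h, Eqn.eval]
    nlinarith [mul_nonneg (sub_nonneg.2 (hyx j)) (sub_nonneg.2 (hyx k))]
  | m j k => simp [linEval, eval, h]

end PPS

open PPS in
/-- Let `x = P(x)` be a minPPS in SNF with LFP `0 < q* < 1`, `0 ≤ y ≤ q*`, and `σ` a
policy with `P^y(N_σ(y)) = N_σ(y)`.  Then: (i) `N_{σ'}(y) ≥ N_σ(y)` for every policy
`σ'`; (ii) `P^y(x) ≥ x` implies `x ≤ N_σ(y)`; (iii) `P^y(x) ≤ x` implies `x ≥ N_σ(y)`;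
(iv) `N_σ(y)` is the unique fixed point of `x = P^y(x)`; (v) `N_σ(y) ≤ q*`. -/
theorem stmt9 {n : ℕ} (S : Sys n) (hval : SysValid S)
    (q : Fin n → ℝ) (hq : IsLFP false S q) (h0 : ∀ i, 0 < q i) (h1 : ∀ i, q i < 1)
    (y : Fin n → ℝ) (hy0 : ∀ i, 0 ≤ y i) (hyq : ∀ i, y i ≤ q i)
    (σ : Fin n → Bool)
    (hfix : linEval false S y (newton false (applyPolicy S σ) y)
      = newton false (applyPolicy S σ) y) :
    (∀ σ' : Fin n → Bool, ∀ i,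
      newton false (applyPolicy S σ) y i ≤ newton false (applyPolicy S σ') y i) ∧
    (∀ x : Fin n → ℝ, (∀ i, x i ≤ linEval false S y x i) →
      ∀ i, x i ≤ newton false (applyPolicy S σ) y i) ∧
    (∀ x : Fin n → ℝ, (∀ i, linEval false S y x i ≤ x i) →
      ∀ i, newton false (applyPolicy S σ) y i ≤ x i) ∧
    (∀ z : Fin n → ℝ, linEval false S y z = z → z = newton false (applyPolicy S σ) y) ∧
    (∀ i, newton false (applyPolicy S σ) y i ≤ q i) := by
  have hmono := fun (τ : Fin n → Bool) (w : Fin n → ℝ)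
      (hw : ∀ i, ∑ j, jac (applyPolicy S τ) y i j * w j ≤ w i) =>
    nonneg_of_jac_mulVec_le hval hq h0 h1 hy0 hyq (applyPolicy_valid hval τ)
      (applyPolicy_isPPS S τ) (eval_le_eval_applyPolicy S τ) hw
  have hnewton := fun τ =>
    linEval_newton (applyPolicy_isPPS S τ) (isUnit_one_sub_jac (hmono τ))
  have hpost : ∀ τ i, newton false (applyPolicy S σ) y i
      ≤ linEval false (applyPolicy S τ) y (newton false (applyPolicy S σ) y) i := fun τ i =>
    (congrFun hfix i).symm.le.trans (linEval_le_linEval_applyPolicy S τ y _ i)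
  have hupper : ∀ x : Fin n → ℝ, (∀ i, x i ≤ linEval false S y x i) →
      ∀ i, x i ≤ newton false (applyPolicy S σ) y i := fun x hx =>
    le_of_le_linEval_of_linEval_le (applyPolicy_isPPS S σ) (hmono σ)
      (fun i => (hx i).trans (linEval_le_linEval_applyPolicy S σ y x i))
      (fun i => (hnewton σ i).le)
  have hlower : ∀ x : Fin n → ℝ, (∀ i, linEval false S y x i ≤ x i) →
      ∀ i, newton false (applyPolicy S σ) y i ≤ x i := by
    intro x hx
    obtain ⟨τ, hτ⟩ := exists_linEval_applyPolicy_eq S y x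
    exact le_of_le_linEval_of_linEval_le (applyPolicy_isPPS S τ) (hmono τ) (hpost τ)
      (hτ ▸ hx)
  refine ⟨fun τ => ?_, hupper, hlower, fun z hz => ?_, hlower q fun i => ?_⟩
  · exact le_of_le_linEval_of_linEval_le (applyPolicy_isPPS S τ) (hmono τ) (hpost τ)
      (fun i => (hnewton τ i).le)
  · exact funext fun i => le_antisymm (hupper z (fun i => (congrFun hz i).ge) i)
      (hlower z (fun i => (congrFun hz i).le) i)
  · exact (linEval_le_eval S hyq i).trans (congrFun hq.1 i).le
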